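/- arXiv:1401.3115 — 2 statements merged into one kernel-verified Lean document; each statement's English description precedes it below -/
import Mathlib

section
/- For every t > 0, the function x ↦ φ_0(x,t) does not change sign on the open interval (0,t): for all x, y with 0 < x < t and 0 < y < t, one has φ_0(x,t) · φ_0(y,t) > 0. -/
open Real Filter

/-- For `a ≠ 0`, the function `φ_a(x,t) = (π / sinh(aπ)) Σ_{k ∈ ℤ} sin(ax + 2kat) e^{−2(kx + k²t)}`. -/
noncomputable def phi (a x t : ℝ) : ℝ :=
  (Real.pi / Real.sinh (a * Real.pi)) *
    ∑' k : ℤ, Real.sin (a * x + 2 * (k : ℝ) * a * t) * Real.exp (-2 * ((k : ℝ) * x + (k : ℝ) ^ 2 * t))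

/-- The function `φ_0(x,t) = Σ_{k ∈ ℤ} (x + 2kt) e^{−2(kx + k²t)}`. -/
noncomputable def phi0 (x t : ℝ) : ℝ :=
  ∑' k : ℤ, (x + 2 * (k : ℝ) * t) * Real.exp (-2 * ((k : ℝ) * x + (k : ℝ) ^ 2 * t))

/-- `φ_a` for all `a ∈ ℝ`, with `φ_0` as the value at `a = 0`. -/
noncomputable def phiA (a x t : ℝ) : ℝ := if a = 0 then phi0 x t else phi a x t

/-- A series whose tail is dominated by a geometric series of ratio below `1 / 2` exceeds
its first term minus the geometric amplitude. -/
lemma HasSum.zero_sub_lt_of_geometric {g : ℕ → ℝ} {S A r : ℝ} (hg : HasSum g S) (hA : 0 < A)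
    (hr : 0 ≤ r) (hr2 : r < 1 / 2) (h : ∀ n, -(A * r ^ (n + 1)) ≤ g (n + 1)) : g 0 - A < S := by
  have hshift : HasSum (fun n ↦ g (n + 1)) (S - g 0) := by
    simpa using (hasSum_nat_add_iff' 1).mpr hg
  have hgeom : HasSum (fun n : ℕ ↦ -(A * r ^ (n + 1))) (-(A * r * (1 - r)⁻¹)) := by
    simpa only [pow_succ', mul_assoc] using
      ((hasSum_geometric_of_lt_one hr (by linarith)).mul_left (A * r)).neg
  have hle := hasSum_le h hgeom hshift
  have hlt : r * (1 - r)⁻¹ < 1 := by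
    rw [← div_eq_mul_inv, div_lt_one (by linarith)]
    linarith
  nlinarith

lemma abs_sin_nat_mul_le (n : ℕ) (θ : ℝ) : |sin (n * θ)| ≤ n * |sin θ| := by
  induction n with
  | zero => simp
  | succ n ih =>
    push_cast
    rw [add_mul, one_mul, sin_add]
    calc |sin (n * θ) * cos θ + cos (n * θ) * sin θ|
        ≤ |sin (n * θ)| * |cos θ| + |cos (n * θ)| * |sin θ| := by
          simpa only [abs_mul] using abs_add_le (sin (n * θ) * cos θ) (cos (n * θ) * sin θ)
      _ ≤ |sin (n * θ)| * 1 + 1 * |sin θ| := by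
          gcongr <;> first | exact abs_cos_le_one _
      _ ≤ (n + 1) * |sin θ| := by linarith

lemma sinKernel_pos {a d : ℝ} (ha : 0 < a) (ha2 : a < 1 / 2) (hd : 1 / 4 ≤ d) :
    0 < HurwitzZeta.sinKernel a d := by
  have hsum := (hasSum_nat_add_iff' 1).mpr
    (HurwitzZeta.hasSum_nat_sinKernel a (show 0 < d by linarith))
  simp only [Finset.sum_range_one, Nat.cast_zero, mul_zero, zero_mul, sub_zero] at hsum
  have hsin : 0 < sin (2 * π * a) :=
    sin_pos_of_pos_of_lt_pi (by positivity) (by nlinarith [pi_pos])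
  have hexp : exp (-π * d * 3) < 1 / 8 := by
    have h1 : exp (-(3 * log 2)) = 1 / 8 := by
      rw [exp_neg, mul_comm, exp_mul, exp_log two_pos]
      norm_num
    rw [← h1, exp_lt_exp]
    nlinarith [pi_gt_three, log_two_lt_d9]
  have key := hsum.zero_sub_lt_of_geometric
    (A := 2 * sin (2 * π * a) * exp (-π * d)) (r := 4 * exp (-π * d * 3))
    (by positivity) (by positivity) (by linarith) ?_
  · simpa [mul_assoc] using key
  · intro n
    have hs := (abs_le.mp (abs_sin_nat_mul_le (n + 1 + 1) (2 * π * a))).1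
    rw [abs_of_pos hsin, mul_comm _ (2 * π * a)] at hs
    have hn : ((n + 1 + 1 : ℕ) : ℝ) ≤ 2 ^ (n + 1) := by
      exact_mod_cast (n + 1).lt_two_pow_self
    have he : exp (-π * ((n + 1 + 1 : ℕ) : ℝ) ^ 2 * d) ≤
        exp (-π * d) * exp (-π * d * 3) ^ (n + 1) := by
      rw [← exp_nat_mul, ← exp_add, exp_le_exp]
      push_cast
      have : 0 < π * d := by positivity
      have hn0 : (0 : ℝ) ≤ n := n.cast_nonneg
      nlinarith [mul_nonneg this.le (mul_nonneg hn0 hn0), mul_nonneg this.le hn0]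
    set m : ℝ := ((n + 1 + 1 : ℕ) : ℝ)
    have hm : 0 ≤ m := Nat.cast_nonneg _
    have hm2 : m * m ≤ 4 ^ (n + 1) := by
      calc m * m ≤ 2 ^ (n + 1) * 2 ^ (n + 1) := by gcongr
        _ = 4 ^ (n + 1) := by rw [← mul_pow]; norm_num
    calc -(2 * sin (2 * π * a) * exp (-π * d) * (4 * exp (-π * d * 3)) ^ (n + 1))
        = -(2 * sin (2 * π * a) * (4 ^ (n + 1) * (exp (-π * d) * exp (-π * d * 3) ^ (n + 1)))) := by
          rw [mul_pow]; ring
      _ ≤ -(2 * sin (2 * π * a) * (m * m * exp (-π * m ^ 2 * d))) := by gcongr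
      _ = 2 * m * (-(m * sin (2 * π * a))) * exp (-π * m ^ 2 * d) := by ring
      _ ≤ 2 * m * sin (2 * π * a * m) * exp (-π * m ^ 2 * d) := by gcongr

/-- Gaussian-weighted identities decrease past the scale of the Gaussian. -/
lemma mul_exp_neg_sq_lt {c u v : ℝ} (hu : 0 < u) (huv : u < v) (h : 1 < c * u * (u + v)) :
    v * exp (-c * v ^ 2) < u * exp (-c * u ^ 2) := by
  have hexp := add_one_le_exp (c * v ^ 2 - c * u ^ 2)
  have hlt : v < u * exp (c * v ^ 2 - c * u ^ 2) := by nlinarith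
  calc v * exp (-c * v ^ 2) < u * exp (c * v ^ 2 - c * u ^ 2) * exp (-c * v ^ 2) := by gcongr
    _ = u * exp (-c * u ^ 2) := by rw [mul_assoc, ← exp_add]; ring_nf

lemma neg_le_mul_exp_add_mul_exp {a c : ℝ} (ha : 0 < a) (ha4 : a ≤ 1 / 4) (hc : 12 ≤ c) {n : ℕ}
    (hn : 1 ≤ n) :
    -(a * exp (-c * a ^ 2) * (8 * exp (-3)) ^ n) ≤
      (n + a) * exp (-c * (n + a) ^ 2) + (-n + a) * exp (-c * (-n + a) ^ 2) := by
  have hn1 : (1 : ℝ) ≤ n := by exact_mod_cast hn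
  have hn2 : (n : ℝ) ≤ n ^ 2 := by nlinarith
  set p : ℝ := 2 * c * n * a with hp
  have hp0 : 0 ≤ p := by positivity
  have hp2 : p ≤ c * n ^ 2 / 2 := by
    have : c * n * a ≤ c * n * (1 / 4) := by gcongr
    nlinarith
  have hsinh : exp p - exp (-p) ≤ 2 * p * exp p := by
    have h := add_one_le_exp (-(2 * p))
    have h2 : exp (-p) = exp (-(2 * p)) * exp p := by rw [← exp_add]; ring_nf
    rw [h2]
    nlinarith [exp_pos p]
  have hw : c * n ^ 2 / 2 ≤ exp (c * n ^ 2 / 4) := by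
    have h := quadratic_le_exp_of_nonneg (show 0 ≤ c * n ^ 2 / 4 by positivity)
    nlinarith [sq_nonneg (c * n ^ 2 / 4 - 1)]
  have hpow : 8 * exp (-3 * n) ≤ (8 * exp (-3)) ^ n := by
    rw [mul_pow, ← exp_nat_mul, mul_comm (-3 : ℝ)]
    gcongr
    exact le_self_pow₀ (by norm_num) (by omega)
  have hdecay : 4 * c * n ^ 2 * exp (p - c * n ^ 2) ≤ (8 * exp (-3)) ^ n := by
    calc 4 * c * n ^ 2 * exp (p - c * n ^ 2)
        = 8 * (c * n ^ 2 / 2) * exp (p - c * n ^ 2) := by ring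
      _ ≤ 8 * exp (c * n ^ 2 / 4) * exp (-(c * n ^ 2 / 2)) := by
          gcongr
          linarith
      _ = 8 * exp (-(c * n ^ 2 / 4)) := by rw [mul_assoc, ← exp_add]; ring_nf
      _ ≤ 8 * exp (-3 * n) := by
          gcongr
          nlinarith
      _ ≤ _ := hpow
  have h1 : exp (-c * (n + a) ^ 2) = exp (-c * a ^ 2) * exp (-c * n ^ 2) * exp (-p) := by
    rw [← exp_add, ← exp_add, hp]; ring_nf
  have h2 : exp (-c * (-n + a) ^ 2) = exp (-c * a ^ 2) * exp (-c * n ^ 2) * exp p := by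
    rw [← exp_add, ← exp_add, hp]; ring_nf
  rw [h1, h2]
  calc -(a * exp (-c * a ^ 2) * (8 * exp (-3)) ^ n)
      ≤ -(a * exp (-c * a ^ 2) * (4 * c * n ^ 2 * exp (p - c * n ^ 2))) := by gcongr
    _ = exp (-c * a ^ 2) * exp (-c * n ^ 2) * (-(n * (2 * p * exp p))) := by
        rw [sub_eq_add_neg, exp_add, hp]; ring_nf
    _ ≤ exp (-c * a ^ 2) * exp (-c * n ^ 2) * (-(n * (exp p - exp (-p)))) := by gcongr
    _ ≤ exp (-c * a ^ 2) * exp (-c * n ^ 2) * ((n + a) * exp (-p) + (-n + a) * exp p) := by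
        gcongr
        nlinarith [exp_pos p, exp_pos (-p)]
    _ = _ := by ring

lemma oddKernel_pos_of_four_le {a y : ℝ} (ha : 0 < a) (ha2 : a < 1 / 2) (hy : 4 ≤ y) :
    0 < HurwitzZeta.oddKernel a y := by
  have hsum := HurwitzZeta.hasSum_int_oddKernel a (show 0 < y by linarith)
  have hc : 12 ≤ π * y := by nlinarith [pi_gt_three]
  have hform (u : ℝ) : -π * u ^ 2 * y = -(π * y) * u ^ 2 := by ring
  simp only [hform] at hsum
  rcases le_or_gt a (1 / 4) with ha4 | ha4
  · have hpair := hsum.nat_add_neg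
    have hr : 8 * exp (-3) < 1 / 2 := by
      rw [exp_neg, ← div_eq_mul_inv, div_lt_iff₀ (exp_pos 3)]
      have h : exp 3 = exp 1 ^ 3 := by rw [← exp_nat_mul]; norm_num
      have h2 : (2.7 : ℝ) ^ 3 ≤ exp 1 ^ 3 := by
        gcongr
        linarith [exp_one_gt_d9]
      rw [h]
      norm_num at h2 ⊢
      linarith
    have key := hpair.zero_sub_lt_of_geometric (A := a * exp (-(π * y) * a ^ 2))
      (r := 8 * exp (-3)) (by positivity) (by positivity) hr fun n ↦ by
        simpa using neg_le_mul_exp_add_mul_exp ha ha4 hc (Nat.le_add_left 1 n)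
    norm_num at key
    linarith
  · have hpair := hsum.nat_add_neg_add_one
    have hpos (n : ℕ) : 0 < ((n : ℤ) + a) * exp (-(π * y) * ((n : ℤ) + a) ^ 2) +
        ((-(n + 1 : ℤ) : ℤ) + a) * exp (-(π * y) * ((-(n + 1 : ℤ) : ℤ) + a) ^ 2) := by
      have hn : (0 : ℝ) ≤ n := n.cast_nonneg
      have h := mul_exp_neg_sq_lt (c := π * y) (u := n + a) (v := n + 1 - a) (by positivity)
        (by linarith) (by
          have h3 : 12 * (1 / 4) ≤ π * y * (n + a) := by gcongr; linarith
          nlinarith)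
      push_cast
      have hsq : (-(n + 1 : ℝ) + a) ^ 2 = (n + 1 - a) ^ 2 := by ring
      rw [hsq]
      linarith
    exact hasSum_lt (fun n ↦ (hpos n).le) (hpos 0) hasSum_zero hpair

lemma oddKernel_pos {a y : ℝ} (ha : 0 < a) (ha2 : a < 1 / 2) (hy : 0 < y) :
    0 < HurwitzZeta.oddKernel a y := by
  rcases le_or_gt 4 y with h | h
  · exact oddKernel_pos_of_four_le ha ha2 h
  · rw [HurwitzZeta.oddKernel_functional_equation]
    have := sinKernel_pos ha ha2 (one_div_le_one_div_of_le hy h.le)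
    positivity

lemma phi0_eq_oddKernel (x : ℝ) {t : ℝ} (ht : 0 < t) :
    phi0 x t = 2 * t * exp (x ^ 2 / (2 * t)) *
      HurwitzZeta.oddKernel (x / (2 * t) : ℝ) (2 * t / π) := by
  have hsum := HurwitzZeta.hasSum_int_oddKernel (x / (2 * t)) (show 0 < 2 * t / π by positivity)
  rw [← hsum.tsum_eq, ← tsum_mul_left, phi0]
  refine tsum_congr fun k ↦ ?_
  have h : -2 * ((k : ℝ) * x + (k : ℝ) ^ 2 * t) =
      x ^ 2 / (2 * t) + -π * (k + x / (2 * t)) ^ 2 * (2 * t / π) := by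
    field_simp
    ring
  rw [h, exp_add]
  field_simp
  ring

lemma phi0_pos {x t : ℝ} (hx : 0 < x) (hxt : x < t) : 0 < phi0 x t := by
  have ht := hx.trans hxt
  rw [phi0_eq_oddKernel x ht]
  have := oddKernel_pos (a := x / (2 * t)) (y := 2 * t / π) (by positivity)
    (by rw [div_lt_iff₀ (by positivity)]; linarith) (by positivity)
  positivity

/-- For every `t > 0`, the function `x ↦ φ_0(x,t)` does not change sign on `(0,t)`:
for all `x, y ∈ (0,t)`, `φ_0(x,t) · φ_0(y,t) > 0`. -/
theorem phi0_no_sign_change (t : ℝ) (ht : 0 < t) (x y : ℝ)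
    (hx : 0 < x) (hxt : x < t) (hy : 0 < y) (hyt : y < t) :
    0 < phi0 x t * phi0 y t := by
  exact mul_pos (phi0_pos hx hxt) (phi0_pos hy hyt)
end

section
/- Let u > 0 and x with 0 < x < u, let (B_s)_{s≥0} be a standard one-dimensional Brownian motion starting from x, and let T_u = inf{ s ≥ 0 : B_s = 0 or B_s = s + u } be the first exit time of the space-time process (s + u, B_s) from the domain D = {(r,z) : 0 ≤ z ≤ r}. Then for every a ∈ ℝ (with φ_a meaning φ_0 when a = 0) and every t > 0, E[ φ_a(B_t, t + u) · 1_{T_u > t} ] = exp(−a²t/2) · φ_a(x, u). In particular (a = 0), E[ φ_0(B_t, t + u) · 1_{T_u > t} ] = φ_0(x, u), so that Q_{x,u}(A) = E[ (φ_0(B_t, t+u)/φ_0(x,u)) · 1_{T_u > t} · 1_A ] defines a probability measure on F_t. -/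
open Real Filter

open MeasureTheory ProbabilityTheory
open scoped NNReal ENNReal

open scoped Topology

/-- The `k`-th term of the series defining `phi a z r`. -/
noncomputable def phiTerm (a : ℝ) (k : ℤ) (z r : ℝ) : ℝ :=
  Real.sin (a * z + 2 * (k : ℝ) * a * r) * Real.exp (-2 * ((k : ℝ) * z + (k : ℝ) ^ 2 * r))

lemma phi_eq_tsum_phiTerm (a z r : ℝ) :
    phi a z r = Real.pi / Real.sinh (a * Real.pi) * ∑' k : ℤ, phiTerm a k z r := rfl

lemma summable_abs_pow_mul_exp (R : ℝ) {r : ℝ} (hr : 0 < r) (n : ℕ) :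
    Summable fun k : ℤ => (|k| ^ n : ℝ) * Real.exp (2 * |(k : ℝ)| * R - 2 * (k : ℝ) ^ 2 * r) := by
  have h := summable_pow_mul_jacobiTheta₂_term_bound (R / Real.pi)
    (T := 2 * r / Real.pi) (by positivity) n
  refine h.congr fun k => ?_
  push_cast
  congr 2
  field_simp
  ring

lemma summable_exp_abs (R : ℝ) {r : ℝ} (hr : 0 < r) :
    Summable fun k : ℤ => Real.exp (2 * |(k : ℝ)| * R - 2 * (k : ℝ) ^ 2 * r) := by
  simpa using summable_abs_pow_mul_exp R hr 0

lemma exp_neg_le_exp_abs {R ρ z r : ℝ} (k : ℤ) (hz : |z| ≤ R) (hr : ρ ≤ r) :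
    Real.exp (-2 * ((k : ℝ) * z + (k : ℝ) ^ 2 * r)) ≤
      Real.exp (2 * |(k : ℝ)| * R - 2 * (k : ℝ) ^ 2 * ρ) := by
  apply Real.exp_le_exp.2
  have h1 : -((k : ℝ) * z) ≤ |(k : ℝ)| * R :=
    (neg_le_abs _).trans (by rw [abs_mul]; gcongr)
  have h2 : (k : ℝ) ^ 2 * ρ ≤ (k : ℝ) ^ 2 * r := by gcongr
  linarith

lemma abs_phiTerm_le_exp (a : ℝ) (k : ℤ) (z r : ℝ) :
    |phiTerm a k z r| ≤ Real.exp (-2 * ((k : ℝ) * z + (k : ℝ) ^ 2 * r)) := by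
  rw [phiTerm, abs_mul, Real.abs_exp]
  exact mul_le_of_le_one_left (Real.exp_pos _).le (Real.abs_sin_le_one _)

lemma tendsto_tsum_phiTerm {ι : Type*} {l : Filter ι} (a : ℝ) {z r : ι → ℝ} {z₀ r₀ : ℝ} (hr₀ : 0 < r₀)
    (hz : Tendsto z l (𝓝 z₀)) (hr : Tendsto r l (𝓝 r₀)) :
    Tendsto (fun i => ∑' k : ℤ, phiTerm a k (z i) (r i)) l (𝓝 (∑' k : ℤ, phiTerm a k z₀ r₀)) := by
  refine tendsto_tsum_of_dominated_convergence
    (summable_exp_abs (|z₀| + 1) (half_pos hr₀)) (fun k => ?_) ?_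
  · have hc : Continuous fun p : ℝ × ℝ => phiTerm a k p.1 p.2 := by
      unfold phiTerm; fun_prop
    have h := (hc.tendsto (z₀, r₀)).comp (hz.prodMk_nhds hr)
    exact h
  · filter_upwards [hz.abs.eventually_lt_const (lt_add_one |z₀|),
      hr.eventually_const_lt (half_lt_self hr₀)] with i h1 h2 k
    exact (abs_phiTerm_le_exp a k _ _).trans (exp_neg_le_exp_abs k h1.le h2.le)

lemma continuous_tsum_phiTerm (a : ℝ) {r : ℝ} (hr : 0 < r) :
    Continuous fun z => ∑' k : ℤ, phiTerm a k z r :=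
  continuous_iff_continuousAt.2 fun _ => tendsto_tsum_phiTerm a hr tendsto_id tendsto_const_nhds

lemma tendsto_phi {ι : Type*} {l : Filter ι} (a : ℝ) {z r : ι → ℝ} {z₀ r₀ : ℝ} (hr₀ : 0 < r₀)
    (hz : Tendsto z l (𝓝 z₀)) (hr : Tendsto r l (𝓝 r₀)) :
    Tendsto (fun i => phi a (z i) (r i)) l (𝓝 (phi a z₀ r₀)) :=
  (tendsto_tsum_phiTerm a hr₀ hz hr).const_mul _

lemma continuous_phi (a : ℝ) {r : ℝ} (hr : 0 < r) : Continuous fun z => phi a z r :=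
  (continuous_tsum_phiTerm a hr).const_mul _

lemma phi_zero_left (a r : ℝ) : phi a 0 r = 0 := by
  have h : ∑' k : ℤ, phiTerm a k 0 r = -∑' k : ℤ, phiTerm a k 0 r := by
    conv_lhs => rw [← (Equiv.neg ℤ).tsum_eq]
    rw [← tsum_neg]
    congr 1 with k
    simp only [phiTerm, Equiv.neg_apply, Int.cast_neg, ← neg_mul, ← Real.sin_neg]
    congr 2 <;> ring
  rw [phi_eq_tsum_phiTerm, show ∑' k : ℤ, phiTerm a k 0 r = 0 by linarith, mul_zero]

lemma phi_diag (a r : ℝ) : phi a r r = 0 := by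
  have h : ∑' k : ℤ, phiTerm a k r r = -∑' k : ℤ, phiTerm a k r r := by
    conv_lhs => rw [← (Equiv.subLeft (-1 : ℤ)).tsum_eq]
    rw [← tsum_neg]
    congr 1 with k
    simp only [phiTerm, Equiv.subLeft_apply, Int.cast_sub, Int.cast_neg, Int.cast_one, ← neg_mul,
      ← Real.sin_neg]
    congr 2 <;> ring
  rw [phi_eq_tsum_phiTerm, show ∑' k : ℤ, phiTerm a k r r = 0 by linarith, mul_zero]

lemma abs_pi_div_sinh_mul_sin_le (a y : ℝ) :
    |Real.pi / Real.sinh (a * Real.pi) * Real.sin (a * y)| ≤ |y| := by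
  rcases eq_or_ne a 0 with rfl | ha
  · simp
  have h1 : |a| * Real.pi ≤ |Real.sinh (a * Real.pi)| := by
    rw [Real.abs_sinh, abs_mul, abs_of_pos Real.pi_pos]
    exact Real.self_le_sinh_iff.2 (by positivity)
  have h2 : |Real.sin (a * y)| ≤ |a| * |y| := by
    rw [← abs_mul]; exact Real.abs_sin_le_abs
  have h3 : 0 < |a| * Real.pi := by positivity
  rw [abs_mul, abs_div, abs_of_pos Real.pi_pos, div_mul_eq_mul_div, div_le_iff₀ (h3.trans_le h1)]
  calc Real.pi * |Real.sin (a * y)| ≤ Real.pi * (|a| * |y|) := by gcongr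
    _ = |y| * (|a| * Real.pi) := by ring
    _ ≤ _ := by gcongr

lemma tendsto_pi_div_sinh_mul_sin (y : ℝ) :
    Tendsto (fun a => Real.pi / Real.sinh (a * Real.pi) * Real.sin (a * y)) (𝓝[≠] 0) (𝓝 y) := by
  have h1 : HasDerivAt (fun a => Real.sinh (a * Real.pi)) Real.pi 0 := by
    simpa using ((hasDerivAt_id (0 : ℝ)).mul_const Real.pi).sinh
  have h2 : HasDerivAt (fun a => Real.sin (a * y)) y 0 := by
    simpa using ((hasDerivAt_id (0 : ℝ)).mul_const y).sin
  have h3 := ((hasDerivAt_iff_tendsto_slope_zero.1 h2).div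
    (hasDerivAt_iff_tendsto_slope_zero.1 h1) Real.pi_ne_zero).const_mul Real.pi
  have h4 : Real.pi * (y / Real.pi) = y := by field_simp
  rw [h4] at h3
  refine h3.congr' ?_
  filter_upwards [self_mem_nhdsWithin] with a ha
  have ha : a ≠ 0 := ha
  simp only [zero_add, zero_mul, Real.sin_zero, Real.sinh_zero, sub_zero, smul_eq_mul, Pi.div_apply]
  rw [mul_div_mul_left _ _ (inv_ne_zero ha)]
  ring

/-- A bound for the terms of the series `phi a z r`, uniform in `a` and in `0 ≤ z ≤ r`. -/
lemma abs_pi_div_sinh_mul_phiTerm_le (a : ℝ) (k : ℤ) {z r : ℝ} (hz : 0 ≤ z) (hzr : z ≤ r) :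
    |Real.pi / Real.sinh (a * Real.pi) * phiTerm a k z r| ≤
      (r + 2 * r * |(k : ℝ)|) * Real.exp (2 * |(k : ℝ)| * r - 2 * (k : ℝ) ^ 2 * r) := by
  have e : a * z + 2 * (k : ℝ) * a * r = a * (z + 2 * k * r) := by ring
  rw [phiTerm, e, ← mul_assoc, abs_mul, Real.abs_exp]
  have hr : 0 ≤ r := hz.trans hzr
  refine mul_le_mul ((abs_pi_div_sinh_mul_sin_le a _).trans ?_)
    (exp_neg_le_exp_abs k (by rwa [abs_of_nonneg hz]) le_rfl) (Real.exp_pos _).le (by positivity)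
  refine (abs_add_le _ _).trans ?_
  rw [abs_mul, abs_mul, abs_of_nonneg hz, abs_of_nonneg hr, abs_two]
  linarith

lemma summable_add_mul_exp {r : ℝ} (hr : 0 < r) :
    Summable fun k : ℤ => (r + 2 * r * |(k : ℝ)|) *
      Real.exp (2 * |(k : ℝ)| * r - 2 * (k : ℝ) ^ 2 * r) := by
  have h := ((summable_exp_abs r hr).mul_left r).add
    ((summable_abs_pow_mul_exp r hr 1).mul_left (2 * r))
  refine h.congr fun k => ?_
  push_cast
  ring

lemma tendsto_phi_phi0 {z r : ℝ} (hr : 0 < r) (hz : 0 ≤ z) (hzr : z ≤ r) :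
    Tendsto (fun a => phi a z r) (𝓝[≠] 0) (𝓝 (phi0 z r)) := by
  simp only [phi_eq_tsum_phiTerm, ← tsum_mul_left, phi0]
  refine tendsto_tsum_of_dominated_convergence (summable_add_mul_exp hr) (fun k => ?_)
    (Eventually.of_forall fun a k => abs_pi_div_sinh_mul_phiTerm_le a k hz hzr)
  refine ((tendsto_pi_div_sinh_mul_sin (z + 2 * k * r)).mul_const _).congr fun a => ?_
  rw [phiTerm, mul_assoc]
  congr 3
  ring

lemma abs_phi_le_tsum (a : ℝ) {z r : ℝ} (hr : 0 < r) (hz : 0 ≤ z) (hzr : z ≤ r) :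
    |phi a z r| ≤ ∑' k : ℤ, (r + 2 * r * |(k : ℝ)|) *
      Real.exp (2 * |(k : ℝ)| * r - 2 * (k : ℝ) ^ 2 * r) := by
  rw [phi_eq_tsum_phiTerm, ← tsum_mul_left, ← Real.norm_eq_abs]
  exact tsum_of_norm_bounded (summable_add_mul_exp hr).hasSum
    fun k => abs_pi_div_sinh_mul_phiTerm_le a k hz hzr

/-- The complex exponential whose imaginary part is `phiTerm a k z r`. -/
noncomputable def phiTermExp (a : ℝ) (k : ℤ) (z r : ℝ) : ℂ :=
  Complex.exp ((-2 * k + a * Complex.I) * z + (-2 * k ^ 2 * r + 2 * k * a * r * Complex.I))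

lemma phiTermExp_im (a : ℝ) (k : ℤ) (z r : ℝ) : (phiTermExp a k z r).im = phiTerm a k z r := by
  have h : ((-2 * k + a * Complex.I) * z + (-2 * k ^ 2 * r + 2 * k * a * r * Complex.I) : ℂ)
      = ((-2 * (k * z + k ^ 2 * r) : ℝ) : ℂ) + ((a * z + 2 * k * a * r : ℝ) : ℂ) * Complex.I := by
    push_cast; ring
  rw [phiTermExp, h, Complex.exp_im, phiTerm, mul_comm (Real.sin _)]
  simp only [Complex.add_re, Complex.add_im, Complex.ofReal_re, Complex.ofReal_im,
    Complex.re_ofReal_mul, Complex.im_ofReal_mul, Complex.I_re, Complex.I_im, mul_zero, add_zero,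
    mul_one, zero_add]

lemma norm_phiTermExp (a : ℝ) (k : ℤ) (z r : ℝ) :
    ‖phiTermExp a k z r‖ = Real.exp (-2 * (k : ℝ) * z) * Real.exp (-2 * (k : ℝ) ^ 2 * r) := by
  have h : ((-2 * k + a * Complex.I) * z + (-2 * k ^ 2 * r + 2 * k * a * r * Complex.I) : ℂ)
      = ((-2 * k * z + -2 * k ^ 2 * r : ℝ) : ℂ) + ((a * z + 2 * k * a * r : ℝ) : ℂ) * Complex.I := by
    push_cast; ring
  rw [phiTermExp, h, Complex.norm_exp, ← Real.exp_add]
  simp only [Complex.add_re, Complex.ofReal_re, Complex.re_ofReal_mul, Complex.I_re, mul_zero,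
    add_zero]

lemma phiTermExp_add (a : ℝ) (k : ℤ) (z w r v : ℝ) :
    phiTermExp a k (z + w) (r + v) = phiTermExp a k z r *
      Complex.exp ((-2 * k + a * Complex.I) * w) *
      Complex.exp (-2 * k ^ 2 * v + 2 * k * a * v * Complex.I) := by
  rw [phiTermExp, phiTermExp, ← Complex.exp_add, ← Complex.exp_add]
  congr 1
  push_cast
  ring

lemma integrable_phiTermExp {Ω : Type*} {m : MeasurableSpace Ω} {P : Measure Ω}
    {X : Ω → ℝ} (hX : Measurable X) (a : ℝ) (k : ℤ) (r : ℝ)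
    (hInt : Integrable (fun ω => Real.exp (-2 * (k : ℝ) * X ω)) P) :
    Integrable (fun ω => phiTermExp a k (X ω) r) P := by
  refine (hInt.mul_const (Real.exp (-2 * (k : ℝ) ^ 2 * r))).mono' ?_
    (Eventually.of_forall fun ω => (norm_phiTermExp a k (X ω) r).le)
  have hc : Continuous fun z : ℝ => phiTermExp a k z r := by unfold phiTermExp; fun_prop
  exact hc.aestronglyMeasurable.comp_measurable hX

lemma integrable_phiTerm {Ω : Type*} {m : MeasurableSpace Ω} {P : Measure Ω}
    {X : Ω → ℝ} (hX : Measurable X) (a : ℝ) (k : ℤ) (r : ℝ)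
    (hInt : Integrable (fun ω => Real.exp (-2 * (k : ℝ) * X ω)) P) :
    Integrable (fun ω => phiTerm a k (X ω) r) P := by
  simpa only [RCLike.im_to_complex, phiTermExp_im] using (integrable_phiTermExp hX a k r hInt).im

lemma setIntegral_phiTerm_add_gaussian {Ω : Type*} {G m : MeasurableSpace Ω} (hG : G ≤ m)
    {P : Measure Ω} {X Y : Ω → ℝ}
    {v : ℝ≥0} (hX : Measurable[G] X) (hY : Measurable Y)
    (hD : P.map (fun ω => Y ω - X ω) = gaussianReal 0 v)
    (hind : Indep (MeasurableSpace.comap (fun ω => Y ω - X ω) Real.measurableSpace) G P)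
    {A : Set Ω} (hA : MeasurableSet[G] A) (a : ℝ) (k : ℤ) (r : ℝ)
    (hIntX : Integrable (fun ω => Real.exp (-2 * (k : ℝ) * X ω)) P)
    (hIntY : Integrable (fun ω => Real.exp (-2 * (k : ℝ) * Y ω)) P) :
    ∫ ω in A, phiTerm a k (Y ω) (r + v) ∂P =
      Real.exp (-a ^ 2 * v / 2) * ∫ ω in A, phiTerm a k (X ω) r ∂P := by
  set l : ℂ := -2 * k + a * Complex.I with hl
  have hXm : Measurable X := hX.mono hG le_rfl
  have hc : Continuous fun z : ℝ => phiTermExp a k z r := by unfold phiTermExp; fun_prop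
  have hU : Measurable[G] (A.indicator fun ω => phiTermExp a k (X ω) r) :=
    (hc.measurable.comp hX).indicator hA
  have hV : Measurable[MeasurableSpace.comap (fun ω => Y ω - X ω) Real.measurableSpace]
      (fun ω => Complex.exp (l * ((Y ω - X ω : ℝ) : ℂ))) := by
    have : Measurable fun d : ℝ => Complex.exp (l * (d : ℂ)) := by fun_prop
    exact this.comp (comap_measurable _)
  have hUV : IndepFun (A.indicator fun ω => phiTermExp a k (X ω) r)
      (fun ω => Complex.exp (l * ((Y ω - X ω : ℝ) : ℂ))) P := by
    rw [IndepFun_iff_Indep]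
    exact indep_of_indep_of_le_left (indep_of_indep_of_le_right hind.symm hV.comap_le) hU.comap_le
  have hmgf : ∫ ω, Complex.exp (l * ((Y ω - X ω : ℝ) : ℂ)) ∂P = Complex.exp (v * l ^ 2 / 2) := by
    have := complexMGF_gaussianReal hD l
    simpa [complexMGF] using this
  have hprod := hUV.integral_mul_eq_mul_integral (hU.mono hG le_rfl).aestronglyMeasurable
    (hV.mono (hY.sub hXm).comap_le le_rfl).aestronglyMeasurable
  rw [integral_indicator (hG _ hA), hmgf] at hprod
  have hmain : ∫ ω in A, phiTermExp a k (Y ω) (r + v) ∂P =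
      (Real.exp (-a ^ 2 * v / 2) : ℂ) * ∫ ω in A, phiTermExp a k (X ω) r ∂P := by
    have e : ∀ ω, A.indicator (fun ω => phiTermExp a k (Y ω) (r + v)) ω =
        (A.indicator (fun ω => phiTermExp a k (X ω) r) *
          fun ω => Complex.exp (l * ((Y ω - X ω : ℝ) : ℂ))) ω *
          Complex.exp (-2 * k ^ 2 * v + 2 * k * a * v * Complex.I) := by
      intro ω
      by_cases hω : ω ∈ A
      · have := phiTermExp_add a k (X ω) (Y ω - X ω) r v
        rw [add_sub_cancel] at this
        simp [hω, this, hl]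
      · simp [hω]
    rw [← integral_indicator (hG _ hA), integral_congr_ae (Eventually.of_forall e),
      integral_mul_const, hprod, mul_assoc, ← Complex.exp_add, mul_comm, Complex.ofReal_exp]
    congr 2
    rw [hl]
    push_cast
    linear_combination (a ^ 2 * v / 2 : ℂ) * Complex.I_sq
  have h1 := congrArg Complex.im hmain
  rw [Complex.im_ofReal_mul] at h1
  have i1 := (integrable_phiTermExp hY a k (r + v) hIntY).restrict (s := A)
  have i2 := (integrable_phiTermExp hXm a k r hIntX).restrict (s := A)
  have e1 := integral_im i1
  have e2 := integral_im i2
  simp only [RCLike.im_to_complex, phiTermExp_im] at e1 e2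
  rw [e1, e2, h1]

lemma integral_exp_mul_add_gaussian {Ω : Type*} {m : MeasurableSpace Ω} {P : Measure Ω}
    {X : Ω → ℝ} {x : ℝ} {v : ℝ≥0}
    (hD : P.map (fun ω => X ω - x) = gaussianReal 0 v) (c : ℝ) :
    Integrable (fun ω => Real.exp (c * X ω)) P ∧
      ∫ ω, Real.exp (c * X ω) ∂P = Real.exp (c * x + c ^ 2 * v / 2) := by
  have hm : AEMeasurable (fun ω => X ω - x) P :=
    aemeasurable_of_map_neZero (by rw [hD]; infer_instance)
  have h1 : Integrable (fun ω => Real.exp (c * (X ω - x))) P := by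
    have h := integrable_exp_mul_gaussianReal (μ := 0) (v := v) c
    rw [← hD] at h
    exact h.comp_aemeasurable hm
  have h2 := mgf_gaussianReal hD c
  rw [mgf] at h2
  have e : ∀ ω, Real.exp (c * X ω) = Real.exp (c * x) * Real.exp (c * (X ω - x)) := fun ω => by
    rw [← Real.exp_add]; ring_nf
  simp only [e]
  refine ⟨h1.const_mul _, ?_⟩
  rw [integral_const_mul, h2, ← Real.exp_add]
  ring_nf

lemma integrable_tsum_of_summable_integral_norm {α ι : Type*} [Countable ι]
    {mα : MeasurableSpace α} {μ : Measure α} {f : ι → α → ℝ} (hf : ∀ i, Integrable (f i) μ)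
    (hs : Summable fun i => ∫ ω, ‖f i ω‖ ∂μ)
    (hm : AEStronglyMeasurable (fun ω => ∑' i, f i ω) μ) :
    Integrable (fun ω => ∑' i, f i ω) μ := by
  refine ⟨hm, ?_⟩
  have h : ∀ ω, ‖∑' i, f i ω‖ₑ ≤ ∑' i, ‖f i ω‖ₑ := fun ω => enorm_tsum_le_tsum_enorm
  refine (lintegral_mono h).trans_lt ?_
  rw [lintegral_tsum fun i => (hf i).1.enorm]
  have e : ∀ i, ∫⁻ ω, ‖f i ω‖ₑ ∂μ = ENNReal.ofReal (∫ ω, ‖f i ω‖ ∂μ) := fun i =>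
    (ofReal_integral_norm_eq_lintegral_enorm (hf i)).symm
  simp only [e]
  rw [← ENNReal.ofReal_tsum_of_nonneg (fun i => integral_nonneg fun ω => norm_nonneg _) hs]
  exact ENNReal.ofReal_lt_top

section BrownianMotion

variable {Ω : Type*} {m : MeasurableSpace Ω} {P : Measure Ω} {F : Filtration ℝ≥0 m}
  {B : ℝ≥0 → Ω → ℝ} {x u : ℝ}

lemma integrable_exp_mul_brownian (hstart : ∀ᵐ ω ∂P, B 0 ω = x)
    (hgauss : ∀ s s' : ℝ≥0, s ≤ s' →
      Measure.map (fun ω => B s' ω - B s ω) P = gaussianReal 0 (s' - s)) (c : ℝ) (s : ℝ≥0) :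
    Integrable (fun ω => Real.exp (c * B s ω)) P ∧
      ∫ ω, Real.exp (c * B s ω) ∂P = Real.exp (c * x + c ^ 2 * s / 2) := by
  refine integral_exp_mul_add_gaussian ?_ c
  have h := hgauss 0 s zero_le
  rw [tsub_zero] at h
  rw [← h]
  refine Measure.map_congr ?_
  filter_upwards [hstart] with ω hω
  rw [hω]

/-- The process `exp (a² s / 2) φ_a (B_s, s + u)`. -/
noncomputable def phiProcess (B : ℝ≥0 → Ω → ℝ) (u a : ℝ) (s : ℝ≥0) (ω : Ω) : ℝ :=
  Real.exp (a ^ 2 * s / 2) * phi a (B s ω) (s + u)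

lemma summable_integral_norm_phiTerm (hu : 0 < u) (hadapted : Adapted F B)
    (hstart : ∀ᵐ ω ∂P, B 0 ω = x)
    (hgauss : ∀ s s' : ℝ≥0, s ≤ s' →
      Measure.map (fun ω => B s' ω - B s ω) P = gaussianReal 0 (s' - s)) (a : ℝ) (s : ℝ≥0) :
    Summable fun k : ℤ => ∫ ω, ‖phiTerm a k (B s ω) (s + u)‖ ∂P := by
  refine Summable.of_nonneg_of_le (fun k => integral_nonneg fun ω => norm_nonneg _)
    (fun k => ?_) (summable_exp_abs |x| hu)
  have h := integrable_exp_mul_brownian hstart hgauss (-2 * (k : ℝ)) s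
  have hle : ∀ ω, ‖phiTerm a k (B s ω) (s + u)‖ ≤
      Real.exp (-2 * (k : ℝ) * B s ω) * Real.exp (-2 * (k : ℝ) ^ 2 * (s + u)) := fun ω => by
    rw [← Real.exp_add]
    refine (abs_phiTerm_le_exp a k (B s ω) (s + u)).trans_eq (congrArg Real.exp ?_)
    ring
  have hInt := integrable_phiTerm ((hadapted s).mono (F.le s) le_rfl) a k (s + u) h.1
  calc _ ≤ _ := integral_mono hInt.norm (h.1.mul_const _) hle
    _ = Real.exp (-2 * ((k : ℝ) * x + (k : ℝ) ^ 2 * u)) := by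
      rw [integral_mul_const, h.2, ← Real.exp_add]; ring_nf
    _ ≤ _ := exp_neg_le_exp_abs k le_rfl le_rfl

lemma integrable_phiProcess (hu : 0 < u) (hadapted : Adapted F B)
    (hstart : ∀ᵐ ω ∂P, B 0 ω = x)
    (hgauss : ∀ s s' : ℝ≥0, s ≤ s' →
      Measure.map (fun ω => B s' ω - B s ω) P = gaussianReal 0 (s' - s)) (a : ℝ) (s : ℝ≥0) :
    Integrable (phiProcess B u a s) P := by
  have hB : Measurable (B s) := (hadapted s).mono (F.le s) le_rfl
  have hInt : ∀ k : ℤ, Integrable (fun ω => phiTerm a k (B s ω) (s + u)) P := fun k =>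
    integrable_phiTerm hB a k (s + u)
      (integrable_exp_mul_brownian hstart hgauss (-2 * (k : ℝ)) s).1
  refine ((integrable_tsum_of_summable_integral_norm hInt
    (summable_integral_norm_phiTerm hu hadapted hstart hgauss a s) ?_).const_mul _).const_mul _
  have hc := continuous_tsum_phiTerm a (by positivity : 0 < (s : ℝ) + u)
  exact hc.aestronglyMeasurable.comp_measurable hB

lemma martingale_phiProcess [IsProbabilityMeasure P] (hu : 0 < u) (hadapted : Adapted F B)
    (hstart : ∀ᵐ ω ∂P, B 0 ω = x)
    (hgauss : ∀ s s' : ℝ≥0, s ≤ s' →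
      Measure.map (fun ω => B s' ω - B s ω) P = gaussianReal 0 (s' - s))
    (hindep : ∀ s s' : ℝ≥0, s ≤ s' →
      Indep (MeasurableSpace.comap (fun ω => B s' ω - B s ω) Real.measurableSpace) (F s) P)
    (a : ℝ) : Martingale (phiProcess B u a) F P := by
  have hmeas : StronglyAdapted F (phiProcess B u a) := fun s =>
    (((continuous_phi a (by positivity : 0 < (s : ℝ) + u)).measurable.comp
      (hadapted s)).const_mul _).stronglyMeasurable
  have hInt := integrable_phiProcess hu hadapted hstart hgauss a
  have hB : ∀ s, Measurable (B s) := fun s => (hadapted s).mono (F.le s) le_rfl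
  have hexp := fun (k : ℤ) s => (integrable_exp_mul_brownian hstart hgauss (-2 * (k : ℝ)) s).1
  have hset : ∀ (s : ℝ≥0) (A : Set Ω), ∫ ω in A, phiProcess B u a s ω ∂P =
      Real.exp (a ^ 2 * s / 2) * (Real.pi / Real.sinh (a * Real.pi) *
        ∑' k : ℤ, ∫ ω in A, phiTerm a k (B s ω) (s + u) ∂P) := fun s A => by
    simp only [phiProcess, phi_eq_tsum_phiTerm, integral_const_mul]
    rw [← integral_tsum_of_summable_integral_norm]
    · exact fun k => (integrable_phiTerm (hB s) a k _ (hexp k s)).restrict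
    · refine Summable.of_nonneg_of_le (fun k => integral_nonneg fun ω => norm_nonneg _)
        (fun k => ?_) (summable_integral_norm_phiTerm hu hadapted hstart hgauss a s)
      exact setIntegral_le_integral (integrable_phiTerm (hB s) a k _ (hexp k s)).norm
        (Eventually.of_forall fun ω => norm_nonneg _)
  refine ⟨hmeas, fun s s' hss => (ae_eq_condExp_of_forall_setIntegral_eq (F.le s) (hInt s')
    (fun _ _ _ => (hInt s).integrableOn) (fun A hA _ => ?_) (hmeas s).aestronglyMeasurable).symm⟩
  have hterm : ∀ k : ℤ, ∫ ω in A, phiTerm a k (B s' ω) (s' + u) ∂P =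
      Real.exp (-a ^ 2 * (s' - s : ℝ≥0) / 2) * ∫ ω in A, phiTerm a k (B s ω) (s + u) ∂P := by
    intro k
    rw [← setIntegral_phiTerm_add_gaussian (F.le s) (hadapted s) (hB s') (hgauss s s' hss)
      (hindep s s' hss) hA a k (s + u) (hexp k s) (hexp k s'), NNReal.coe_sub hss]
    congr! 3
    ring
  rw [hset, hset]
  simp only [hterm, tsum_mul_left]
  rw [mul_left_comm _ (Real.exp (-a ^ 2 * _ / 2)), ← mul_assoc (Real.exp (a ^ 2 * s' / 2)),
    ← Real.exp_add, NNReal.coe_sub hss]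
  congr 2
  ring

end BrownianMotion

section ExitTime

variable {Ω : Type*} {B : ℝ≥0 → Ω → ℝ} {u : ℝ}

/-- The event that the path hits `0` or the line `r + u` up to time `s`, written with countably
many times only, so that it is measurable at time `s`. For continuous paths it is the event
`∃ r ≤ s, B r ω = 0 ∨ B r ω = r + u`. -/
def hitEvent (B : ℝ≥0 → Ω → ℝ) (u : ℝ) (s : ℝ≥0) : Set Ω :=
  {ω | ∀ n : ℕ, ∃ q : ℚ≥0, |B (min q s) ω * (((min (q : ℝ≥0) s : ℝ≥0) : ℝ) + u - B (min q s) ω)|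
    < 1 / ((n : ℝ) + 1)}

lemma measurableSet_hitEvent {m : MeasurableSpace Ω} {F : Filtration ℝ≥0 m}
    (hadapted : Adapted F B) (s : ℝ≥0) : MeasurableSet[F s] (hitEvent B u s) := by
  have hB : ∀ q : ℚ≥0, Measurable[F s] (B (min q s)) := fun q =>
    (hadapted _).mono (F.mono (min_le_right _ _)) le_rfl
  have e : hitEvent B u s = ⋂ n : ℕ, ⋃ q : ℚ≥0, {ω | |B (min q s) ω *
      (((min (q : ℝ≥0) s : ℝ≥0) : ℝ) + u - B (min q s) ω)| < 1 / ((n : ℝ) + 1)} := by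
    ext ω; simp [hitEvent]
  rw [e]
  refine MeasurableSet.iInter fun n => MeasurableSet.iUnion fun q => ?_
  have hc : Measurable fun z : ℝ => |z * (((min (q : ℝ≥0) s : ℝ≥0) : ℝ) + u - z)| := by fun_prop
  exact (hc.comp (hB q)) measurableSet_Iio

lemma mem_hitEvent_iff {ω : Ω} (hc : Continuous fun s => B s ω) (s : ℝ≥0) :
    ω ∈ hitEvent B u s ↔ ∃ r ≤ s, B r ω = 0 ∨ B r ω = r + u := by
  set g : ℝ≥0 → ℝ := fun r => |B r ω * ((r : ℝ) + u - B r ω)| with hg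
  have hgc : Continuous g := by fun_prop
  have hzero : ∀ r, g r = 0 ↔ B r ω = 0 ∨ B r ω = r + u := fun r => by
    rw [hg, abs_eq_zero, mul_eq_zero, sub_eq_zero, eq_comm (a := (r : ℝ) + u)]
  constructor
  · intro h
    obtain ⟨r, hr, hmin⟩ := isCompact_Icc.exists_isMinOn (Set.nonempty_Icc.2 (zero_le (a := s)))
      hgc.continuousOn
    refine ⟨r, hr.2, (hzero r).1 (le_antisymm ?_ (abs_nonneg _))⟩
    refine ge_of_tendsto' tendsto_one_div_add_atTop_nhds_zero_nat fun n => ?_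
    obtain ⟨q, hq⟩ := h n
    exact (hmin ⟨zero_le, min_le_right (q : ℝ≥0) s⟩).trans hq.le
  · rintro ⟨r, hrs, hr⟩ n
    have hopen : IsOpen {p : ℝ≥0 | g (min p s) < 1 / ((n : ℝ) + 1)} :=
      isOpen_lt (by fun_prop) continuous_const
    have hdense : DenseRange ((↑) : ℚ≥0 → ℝ≥0) := 
      dense_of_exists_between fun a b hab => by
        obtain ⟨q, h1, h2⟩ := exists_rat_btwn (NNReal.coe_lt_coe.2 hab)
        lift q to ℚ≥0 using by exact_mod_cast a.coe_nonneg.trans h1.le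
        rw [Rat.cast_nnratCast] at h1 h2
        exact ⟨q, ⟨q, rfl⟩, NNReal.coe_lt_coe.1 h1, NNReal.coe_lt_coe.1 h2⟩
    refine hdense.exists_mem_open hopen ⟨r, ?_⟩
    simp only [Set.mem_ofPred_eq, min_eq_left hrs, (hzero r).2 hr]
    positivity

lemma sInf_coe_hit_eq {ω : Ω} (hc : Continuous fun s => B s ω)
    (hne : {s : ℝ≥0 | B s ω = 0 ∨ B s ω = (s : ℝ) + u}.Nonempty) :
    ∃ r : ℝ≥0, (B r ω = 0 ∨ B r ω = r + u) ∧
      sInf ((fun s : ℝ≥0 => (s : ℝ≥0∞)) '' {s : ℝ≥0 | B s ω = 0 ∨ B s ω = (s : ℝ) + u}) = r := by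
  have hclosed : IsClosed {s : ℝ≥0 | B s ω = 0 ∨ B s ω = (s : ℝ) + u} :=
    (isClosed_eq hc continuous_const).union (isClosed_eq hc (by fun_prop))
  refine ⟨_, hclosed.csInf_mem hne (OrderBot.bddBelow _), ?_⟩
  rw [ENNReal.coe_sInf hne, sInf_image]

lemma sInf_coe_hit_le_iff {ω : Ω} (hc : Continuous fun s => B s ω) (s : ℝ≥0) :
    sInf ((fun s : ℝ≥0 => (s : ℝ≥0∞)) '' {s : ℝ≥0 | B s ω = 0 ∨ B s ω = (s : ℝ) + u}) ≤ s ↔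
      ω ∈ hitEvent B u s := by
  rw [mem_hitEvent_iff hc]
  constructor
  · intro h
    rcases Set.eq_empty_or_nonempty {s : ℝ≥0 | B s ω = 0 ∨ B s ω = (s : ℝ) + u} with he | hne
    · simp [he] at h
    · obtain ⟨r, hr, he⟩ := sInf_coe_hit_eq hc hne
      rw [he] at h
      exact ⟨r, by exact_mod_cast h, hr⟩
  · rintro ⟨r, hrs, hr⟩
    exact (sInf_le (Set.mem_image_of_mem (fun s : ℝ≥0 => (s : ℝ≥0∞))
      (show r ∈ {s : ℝ≥0 | B s ω = 0 ∨ B s ω = (s : ℝ) + u} from hr))).trans (ENNReal.coe_le_coe.2 hrs)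

lemma mem_Icc_of_notMem_hitEvent {x : ℝ} (hx : 0 < x) (hxu : x < u) {ω : Ω}
    (hc : Continuous fun s => B s ω) (h0 : B 0 ω = x) {t : ℝ≥0} (h : ω ∉ hitEvent B u t) :
    B t ω ∈ Set.Icc 0 ((t : ℝ) + u) := by
  rw [mem_hitEvent_iff hc] at h
  push Not at h
  constructor
  · by_contra! hneg
    obtain ⟨r, hr, hr0⟩ := intermediate_value_Icc' (zero_le (a := t)) hc.continuousOn
      (⟨hneg.le, by rw [h0]; exact hx.le⟩ : (0 : ℝ) ∈ Set.Icc (B t ω) (B 0 ω))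
    exact (h r hr.2).1 hr0
  · by_contra! hpos
    have hc' : Continuous fun s : ℝ≥0 => (s : ℝ) + u - B s ω := by fun_prop
    obtain ⟨r, hr, hr0⟩ := intermediate_value_Icc' (zero_le (a := t)) hc'.continuousOn
      (⟨by linarith, by rw [h0, NNReal.coe_zero]; linarith⟩ : (0 : ℝ) ∈
        Set.Icc ((t : ℝ) + u - B t ω) (((0 : ℝ≥0) : ℝ) + u - B 0 ω))
    exact (h r hr.2).2 (by linarith [hr0])

/-- The least `i` such that `ω ∈ A (i t / N)`, or `N` if there is no such `i < N`. -/
noncomputable def gridIndex (A : ℝ≥0 → Set Ω) (t : ℝ≥0) (N : ℕ) (ω : Ω) : ℕ :=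
  sInf {i : ℕ | ω ∈ A (i * t / N) ∨ N ≤ i}

/-- The first of the times `i t / N`, `i < N`, with `ω ∈ A (i t / N)`, or `t` if there is none. -/
noncomputable def gridTime (A : ℝ≥0 → Set Ω) (t : ℝ≥0) (N : ℕ) (ω : Ω) : ℝ≥0 :=
  gridIndex A t N ω * t / N

variable {A : ℝ≥0 → Set Ω} {t : ℝ≥0} {N : ℕ}

lemma gridIndex_mem (A : ℝ≥0 → Set Ω) (t : ℝ≥0) (N : ℕ) (ω : Ω) :
    ω ∈ A (gridTime A t N ω) ∨ N ≤ gridIndex A t N ω :=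
  Nat.sInf_mem (s := {i : ℕ | ω ∈ A (i * t / N) ∨ N ≤ i}) ⟨N, Or.inr le_rfl⟩

lemma gridIndex_le (A : ℝ≥0 → Set Ω) (t : ℝ≥0) (N : ℕ) (ω : Ω) : gridIndex A t N ω ≤ N :=
  Nat.sInf_le (Or.inr le_rfl)

lemma gridTime_le (A : ℝ≥0 → Set Ω) (t : ℝ≥0) (N : ℕ) (ω : Ω) : gridTime A t N ω ≤ t := by
  have h : (gridIndex A t N ω : ℝ≥0) ≤ N := by exact_mod_cast gridIndex_le A t N ω
  refine div_le_of_le_mul₀ zero_le zero_le ?_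
  rw [mul_comm t]
  gcongr

lemma gridTime_eq_of_le (hN : 0 < N) {ω : Ω} (h : N ≤ gridIndex A t N ω) :
    gridTime A t N ω = t := by
  have hN' : (N : ℝ≥0) ≠ 0 := by exact_mod_cast hN.ne'
  rw [gridTime, le_antisymm (gridIndex_le A t N ω) h, mul_div_cancel_left₀ _ hN']

lemma isStoppingTime_gridTime {m : MeasurableSpace Ω} {F : Filtration ℝ≥0 m}
    (hA : ∀ s, MeasurableSet[F s] (A s)) :
    IsStoppingTime F fun ω => ((gridTime A t N ω : ℝ≥0) : WithTop ℝ≥0) := by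
  intro s
  have e : {ω | ((gridTime A t N ω : ℝ≥0) : WithTop ℝ≥0) ≤ s} =
      ⋃ i : ℕ, ⋃ _ : (i * t / N : ℝ≥0) ≤ s, {ω | ω ∈ A (i * t / N) ∨ N ≤ i} := by
    ext ω
    simp only [Set.mem_ofPred_eq, WithTop.coe_le_coe, Set.mem_iUnion, exists_prop]
    constructor
    · exact fun h => ⟨gridIndex A t N ω, h, gridIndex_mem A t N ω⟩
    · rintro ⟨i, his, hi⟩
      have h : gridIndex A t N ω ≤ i := Nat.sInf_le hi
      refine le_trans ?_ his
      rw [gridTime]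
      gcongr
  rw [e]
  refine MeasurableSet.iUnion fun i => MeasurableSet.iUnion fun his => ?_
  exact (F.mono his _ (hA _)).union (MeasurableSet.const _)

lemma countable_range_gridTime (A : ℝ≥0 → Set Ω) (t : ℝ≥0) (N : ℕ) :
    (Set.range fun ω => ((gridTime A t N ω : ℝ≥0) : WithTop ℝ≥0)).Countable := by
  refine (Set.countable_range fun i : ℕ => ((i * t / N : ℝ≥0) : WithTop ℝ≥0)).mono ?_
  rintro _ ⟨ω, rfl⟩
  exact ⟨gridIndex A t N ω, rfl⟩

lemma gridTime_eq_of_forall_notMem (hN : 0 < N) {ω : Ω} (h : ∀ s ≤ t, ω ∉ A s) :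
    gridTime A t N ω = t :=
  gridTime_eq_of_le hN ((gridIndex_mem A t N ω).resolve_left (h _ (gridTime_le A t N ω)))

lemma le_gridTime (hN : 0 < N) {ω : Ω} {r : ℝ≥0} (hr : r ≤ t) (h : ∀ s, ω ∈ A s ↔ r ≤ s) :
    r ≤ gridTime A t N ω := by
  rcases gridIndex_mem A t N ω with h1 | h1
  · exact (h _).1 h1
  · rwa [gridTime_eq_of_le hN h1]

lemma gridTime_le_add {ω : Ω} {r : ℝ≥0} (h : ∀ s, ω ∈ A s ↔ r ≤ s) :
    gridTime A t N ω ≤ r + t / N := by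
  rcases Nat.eq_zero_or_pos (gridIndex A t N ω) with h0 | h0
  · simp [gridTime, h0]
  · have h1 : ¬(ω ∈ A (((gridIndex A t N ω - 1 : ℕ) : ℝ≥0) * t / N) ∨ N ≤ gridIndex A t N ω - 1) :=
      Nat.notMem_of_lt_sInf (s := {i : ℕ | ω ∈ A (i * t / N) ∨ N ≤ i}) (Nat.sub_lt h0 one_pos)
    rw [not_or, h, not_le] at h1
    have h2 : (gridIndex A t N ω : ℝ≥0) = ((gridIndex A t N ω - 1 : ℕ) : ℝ≥0) + 1 := by
      exact_mod_cast (Nat.sub_add_cancel h0).symm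
    rw [gridTime, h2, add_mul, add_div, one_mul]
    gcongr
    exact h1.1.le

lemma tendsto_gridTime {ω : Ω} {r : ℝ≥0} (hr : r ≤ t) (h : ∀ s, ω ∈ A s ↔ r ≤ s) :
    Tendsto (fun n : ℕ => gridTime A t (n + 1) ω) atTop (𝓝 r) := by
  refine tendsto_of_tendsto_of_tendsto_of_le_of_le (g := fun _ => r)
    (h := fun n : ℕ => r + t / ((n + 1 : ℕ) : ℝ≥0)) tendsto_const_nhds ?_
    (fun n => le_gridTime n.succ_pos hr h) (fun n => gridTime_le_add h)
  have h1 : Tendsto (fun n : ℕ => t / ((n + 1 : ℕ) : ℝ≥0)) atTop (𝓝 0) :=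
    (tendsto_const_div_atTop_nhds_zero_nat t).comp (tendsto_add_atTop_nat 1)
  simpa using h1.const_add r

end ExitTime

section Killed

variable {Ω : Type*} {m : MeasurableSpace Ω} {P : Measure Ω} [IsProbabilityMeasure P]
  {F : Filtration ℝ≥0 m} {B : ℝ≥0 → Ω → ℝ} {x u : ℝ}

lemma tendsto_phiProcess_gridTime (hu : 0 < u) (a : ℝ) {t : ℝ≥0} {ω : Ω}
    (hc : Continuous fun s => B s ω) :
    Tendsto (fun n : ℕ => phiProcess B u a (gridTime (hitEvent B u) t (n + 1) ω) ω) atTop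
      (𝓝 ((hitEvent B u t)ᶜ.indicator (phiProcess B u a t) ω)) := by
  by_cases h : ω ∈ hitEvent B u t
  · have hne := ((mem_hitEvent_iff hc t).1 h).imp fun r hr => hr.2
    obtain ⟨r, hr, he⟩ := sInf_coe_hit_eq hc hne
    have hiff : ∀ s, ω ∈ hitEvent B u s ↔ r ≤ s := fun s => by
      rw [← sInf_coe_hit_le_iff hc, he, ENNReal.coe_le_coe]
    have ht := tendsto_gridTime ((hiff t).1 h) hiff
    have hzero : phi a (B r ω) (r + u) = 0 := by
      rcases hr with hr | hr
      · rw [hr, phi_zero_left]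
      · rw [hr, phi_diag]
    have ht' := (NNReal.continuous_coe.tendsto r).comp ht
    have hphi := tendsto_phi a (by positivity : 0 < (r : ℝ) + u) ((hc.tendsto r).comp ht)
      (ht'.add_const u)
    have hexp : Tendsto (fun n : ℕ => Real.exp
        (a ^ 2 * (gridTime (hitEvent B u) t (n + 1) ω : ℝ) / 2)) atTop
        (𝓝 (Real.exp (a ^ 2 * (r : ℝ) / 2))) :=
      (Real.continuous_exp.tendsto _).comp ((ht'.const_mul _).div_const _)
    have := hexp.mul hphi
    rw [hzero, mul_zero] at this
    simpa [h, phiProcess] using this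
  · have hs : ∀ s ≤ t, ω ∉ hitEvent B u s := fun s hst hs => by
      rw [mem_hitEvent_iff hc] at h hs
      exact h (hs.imp fun r hr => ⟨hr.1.trans hst, hr.2⟩)
    simp [h, gridTime_eq_of_forall_notMem (Nat.succ_pos _) hs]

lemma setIntegral_compl_hitEvent_phi (hu : 0 < u) (hadapted : Adapted F B)
    (hcont : ∀ᵐ ω ∂P, Continuous fun s : ℝ≥0 => B s ω)
    (hstart : ∀ᵐ ω ∂P, B 0 ω = x)
    (hgauss : ∀ s s' : ℝ≥0, s ≤ s' →
      Measure.map (fun ω => B s' ω - B s ω) P = gaussianReal 0 (s' - s))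
    (hindep : ∀ s s' : ℝ≥0, s ≤ s' →
      Indep (MeasurableSpace.comap (fun ω => B s' ω - B s ω) Real.measurableSpace) (F s) P)
    (a : ℝ) (t : ℝ≥0) :
    ∫ ω in (hitEvent B u t)ᶜ, phi a (B t ω) (t + u) ∂P =
      Real.exp (-(a ^ 2) * t / 2) * phi a x u := by
  have hmart := martingale_phiProcess hu hadapted hstart hgauss hindep a
  have hInt := integrable_phiProcess hu hadapted hstart hgauss a
  have hmeasF : ∀ s, MeasurableSet[F s] (hitEvent B u s) := measurableSet_hitEvent hadapted
  have hmeas : MeasurableSet (hitEvent B u t) := F.le t _ (hmeasF t)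
  have hτ := fun n : ℕ => isStoppingTime_gridTime (t := t) (N := n + 1) hmeasF
  have hτle : ∀ n ω, ((gridTime (hitEvent B u) t (n + 1) ω : ℝ≥0) : WithTop ℝ≥0) ≤ t :=
    fun n ω => WithTop.coe_le_coe.2 (gridTime_le _ _ _ _)
  have hG : ∀ n : ℕ, (hτ n).measurableSpace ≤ m := fun n =>
    (hτ n).measurableSpace_le_of_le (hτle n)
  have hopt : ∀ n : ℕ, (fun ω => phiProcess B u a (gridTime (hitEvent B u) t (n + 1) ω) ω)
      =ᵐ[P] P[phiProcess B u a t | (hτ n).measurableSpace] := fun n =>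
    hmart.stoppedValue_ae_eq_condExp_of_le_const_of_countable_range (hτ n) (hτle n)
      (countable_range_gridTime _ _ _)
  have hui := (hInt t).uniformIntegrable_condExp hG
  have hlim : ∀ᵐ ω ∂P, Tendsto (fun n => (P[phiProcess B u a t | (hτ n).measurableSpace]) ω) atTop
      (𝓝 ((hitEvent B u t)ᶜ.indicator (phiProcess B u a t) ω)) := by
    filter_upwards [hcont, ae_all_iff.2 hopt] with ω hω hoptω
    exact (tendsto_phiProcess_gridTime hu a hω).congr hoptω
  have hLp := tendsto_Lp_finite_of_tendsto_ae le_rfl ENNReal.one_ne_top (fun n => hui.1 n)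
    (memLp_one_iff_integrable.2 ((hInt t).indicator hmeas.compl)) hui.2.1 hlim
  have hconv := tendsto_integral_of_L1' _ ((hInt t).indicator hmeas.compl).aestronglyMeasurable
    (Eventually.of_forall fun n => integrable_condExp) hLp
  simp only [integral_condExp (hG _)] at hconv
  have heq := tendsto_nhds_unique tendsto_const_nhds hconv
  rw [integral_indicator hmeas.compl] at heq
  have h0 : ∫ ω, phiProcess B u a t ω ∂P = phi a x u := by
    have h1 := hmart.setIntegral_eq (zero_le (a := t)) (MeasurableSet.univ)
    rw [setIntegral_univ, setIntegral_univ] at h1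
    rw [← h1]
    have h2 : phiProcess B u a 0 =ᵐ[P] fun _ => phi a x u := by
      filter_upwards [hstart] with ω hω
      simp [phiProcess, hω]
    rw [integral_congr_ae h2]
    simp
  rw [h0] at heq
  simp only [phiProcess, integral_const_mul] at heq
  rw [heq, ← mul_assoc, ← Real.exp_add]
  ring_nf
  simp

end Killed

/-- Let `u > 0`, `0 < x < u`, let `(B_s)_{s ≥ 0}` be a standard one-dimensional Brownian motion
starting from `x`, and let `T_u = inf{s ≥ 0 : B_s = 0 or B_s = s + u}` be the first exit time of
the space-time process `(s + u, B_s)` from `D = {(r,z) : 0 ≤ z ≤ r}` (with `inf ∅ = ∞`). Then for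
every `a ∈ ℝ` (where `φ_a` means `φ_0` when `a = 0`) and every `t > 0`,
`E[φ_a(B_t, t + u) · 1_{T_u > t}] = exp(−a²t/2) · φ_a(x, u)`. In particular for `a = 0`,
`E[φ_0(B_t, t + u) · 1_{T_u > t}] = φ_0(x, u)`, so `Q_{x,u}` is a probability measure. -/
theorem killed_spacetime_bm_expectation {Ω : Type*} [m : MeasurableSpace Ω] {P : Measure Ω}
    [IsProbabilityMeasure P] (F : Filtration ℝ≥0 m) (B : ℝ≥0 → Ω → ℝ) (x u : ℝ)
    (hu : 0 < u) (hx : 0 < x) (hxu : x < u)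
    (hadapted : Adapted F B)
    (hcont : ∀ᵐ ω ∂P, Continuous fun s : ℝ≥0 => B s ω)
    (hstart : ∀ᵐ ω ∂P, B 0 ω = x)
    (hgauss : ∀ s s' : ℝ≥0, s ≤ s' →
      Measure.map (fun ω => B s' ω - B s ω) P = gaussianReal 0 (s' - s))
    (hindep : ∀ s s' : ℝ≥0, s ≤ s' →
      Indep (MeasurableSpace.comap (fun ω => B s' ω - B s ω) Real.measurableSpace) (F s) P)
    (T : Ω → ℝ≥0∞)
    (hT : ∀ ω, T ω =
      sInf ((fun s : ℝ≥0 => (s : ℝ≥0∞)) ''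
        {s : ℝ≥0 | B s ω = 0 ∨ B s ω = (s : ℝ) + u})) :
    ∀ a : ℝ, ∀ t : ℝ≥0, 0 < t →
      ∫ ω in {ω | (t : ℝ≥0∞) < T ω}, phiA a (B t ω) ((t : ℝ) + u) ∂P
        = Real.exp (-(a ^ 2) * (t : ℝ) / 2) * phiA a x u := by
  intro a t _
  have hset : {ω | (t : ℝ≥0∞) < T ω} =ᵐ[P] ((hitEvent B u t)ᶜ : Set Ω) := by
    rw [Filter.eventuallyEq_set]
    filter_upwards [hcont] with ω hω
    rw [hT ω, ← not_le, sInf_coe_hit_le_iff hω, Set.mem_compl_iff]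
  rw [Measure.restrict_congr_set hset]
  have hphi := setIntegral_compl_hitEvent_phi hu hadapted hcont hstart hgauss hindep
  rcases ne_or_eq a 0 with ha | rfl
  · simpa only [phiA, if_neg ha] using hphi a t
  · simp only [phiA, if_true]
    have hr : 0 < (t : ℝ) + u := by positivity
    have hB : Measurable (B t) := (hadapted t).mono (F.le t) le_rfl
    have hmeas : MeasurableSet (hitEvent B u t) := F.le t _ (measurableSet_hitEvent hadapted t)
    have hdom : ∀ᵐ ω ∂P.restrict (hitEvent B u t)ᶜ, B t ω ∈ Set.Icc 0 ((t : ℝ) + u) := by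
      rw [ae_restrict_iff' hmeas.compl]
      filter_upwards [hcont, hstart] with ω hω h0 hmem
      exact mem_Icc_of_notMem_hitEvent hx hxu hω h0 hmem
    have hlim : Tendsto (fun b => ∫ ω in (hitEvent B u t)ᶜ, phi b (B t ω) ((t : ℝ) + u) ∂P)
        (𝓝[≠] 0) (𝓝 (∫ ω in (hitEvent B u t)ᶜ, phi0 (B t ω) ((t : ℝ) + u) ∂P)) := by
      refine tendsto_integral_filter_of_norm_le_const
        (Eventually.of_forall fun b =>
          (continuous_phi b hr).aestronglyMeasurable.comp_measurable hB)
        ⟨∑' k : ℤ, (((t : ℝ) + u) + 2 * ((t : ℝ) + u) * |(k : ℝ)|) *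
          Real.exp (2 * |(k : ℝ)| * ((t : ℝ) + u) - 2 * (k : ℝ) ^ 2 * ((t : ℝ) + u)),
          Eventually.of_forall fun b => ?_⟩ ?_
      · filter_upwards [hdom] with ω hω
        exact abs_phi_le_tsum b hr hω.1 hω.2
      · filter_upwards [hdom] with ω hω
        exact tendsto_phi_phi0 hr hω.1 hω.2
    have hlim' : Tendsto (fun b : ℝ => Real.exp (-(b ^ 2) * (t : ℝ) / 2) * phi b x u)
        (𝓝[≠] 0) (𝓝 (Real.exp (-(0 ^ 2) * (t : ℝ) / 2) * phi0 x u)) := by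
      refine Tendsto.mul ?_ (tendsto_phi_phi0 hu hx.le hxu.le)
      have hc : Continuous fun b : ℝ => Real.exp (-(b ^ 2) * (t : ℝ) / 2) := by fun_prop
      exact (hc.tendsto 0).mono_left nhdsWithin_le_nhds
    exact tendsto_nhds_unique hlim (hlim'.congr fun b => (hphi b t).symm)
end
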